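/- arXiv:1009.2229 — 5 statements merged into one kernel-verified Lean document; each statement's English description precedes it below -/
import Mathlib

section
/- Let R be a Noetherian ring and M an Artinian R-module with Supp_R(M) = {m_1, ..., m_s} ⊆ Max(R). Then M decomposes as an internal direct sum M = Γ_{m_1}(M) ⊕ ... ⊕ Γ_{m_s}(M), where Γ_{m_i}(M) = {x ∈ M | m_i^n x = 0 for some n ≥ 0}. -/
/-- The `m`-torsion submodule `Γ_m(M) = {x ∈ M | m^n x = 0 for some n}`. -/
def torsionPart (R : Type*) [CommRing R] (M : Type*) [AddCommGroup M] [Module R M]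
    (m : Ideal R) : Submodule R M :=
  ⨆ n : ℕ, Submodule.torsionBySet R M ((m ^ n : Ideal R) : Set R)

/-- Let `R` be a Noetherian ring and `M` an Artinian `R`-module whose support
consists of the (finitely many) maximal ideals `m ∈ s`. Then `M` is the internal direct sum of
the torsion parts `Γ_m(M)` for `m ∈ s`. -/
theorem artinian_internal_direct_sum_torsion_parts
    (R M : Type*) [CommRing R] [IsNoetherianRing R]
    [AddCommGroup M] [Module R M] [IsArtinian R M]
    (s : Finset (Ideal R))
    (hmax : ∀ m ∈ s, (m : Ideal R).IsMaximal)
    (hsupp : Module.support R M = {p : PrimeSpectrum R | p.asIdeal ∈ s}) :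
    haveI : DecidableEq { x // x ∈ s } := Classical.decEq _
    DirectSum.IsInternal (fun m : s => torsionPart R M (m : Ideal R)) := by
  have hcop : ∀ n : ℕ, (s : Set (Ideal R)).Pairwise fun i j => i ^ n ⊔ j ^ n = ⊤ := by
    intro n i hi j hj hij
    have h : IsCoprime i j :=
      Ideal.isCoprime_iff_sup_eq.mpr ((hmax i hi).coprime_of_ne (hmax j hj) hij)
    exact Ideal.isCoprime_iff_sup_eq.mp (h.pow (m := n) (n := n))
  refine @DirectSum.isInternal_submodule_of_iSupIndep_of_iSup_eq_top _ _ _ (Classical.decEq _) _ _ _ _ ?_ ?_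
  · intro i
    have hind : ∀ n : ℕ, iSupIndep fun m : s =>
        Submodule.torsionBySet R M (((m : Ideal R) ^ n : Ideal R) : Set R) := fun n =>
      iSupIndep_comp_coe_iff_supIndep.mpr
        (Submodule.supIndep_torsionBySet_ideal (M := M) (p := fun m : Ideal R => m ^ n) (hcop n))
    have hmono : ∀ m : Ideal R, Monotone fun n : ℕ =>
        Submodule.torsionBySet R M ((m ^ n : Ideal R) : Set R) :=
      fun m a b hab => Submodule.torsionBySet_le_torsionBySet_pow a b hab m
    have hmono2 : Monotone fun n : ℕ => ⨆ (j : s) (_ : j ≠ i),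
        Submodule.torsionBySet R M (((j : Ideal R) ^ n : Ideal R) : Set R) :=
      fun a b hab => iSup₂_mono fun j _ => hmono j hab
    have hswap : (⨆ (j : s) (_ : j ≠ i), torsionPart R M (j : Ideal R)) ≤
        ⨆ n : ℕ, ⨆ (j : s) (_ : j ≠ i),
          Submodule.torsionBySet R M (((j : Ideal R) ^ n : Ideal R) : Set R) := by
      refine iSup₂_le fun j hj => iSup_le fun n => ?_
      exact le_iSup_of_le n (le_iSup₂_of_le j hj le_rfl)
    rw [Submodule.disjoint_def]
    intro x hx hy
    obtain ⟨a, ha⟩ := (Submodule.mem_iSup_of_directed _ (hmono i).directed_le).mp hx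
    obtain ⟨b, hb⟩ := (Submodule.mem_iSup_of_directed _ hmono2.directed_le).mp (hswap hy)
    exact Submodule.disjoint_def.mp (hind (max a b) i) x
      (hmono i (le_max_left a b) ha) (hmono2 (le_max_right a b) hb)
  · rw [eq_top_iff]
    intro x _
    have hle : (⨅ m ∈ s, m : Ideal R) ≤ (Ideal.torsionOf R M x).radical := by
      rw [Ideal.radical_eq_sInf]
      refine le_sInf ?_
      rintro p ⟨hp, hpp⟩
      have hmem : (⟨p, hpp⟩ : PrimeSpectrum R) ∈ Module.support R M := by
        rw [Module.mem_support_iff_exists_annihilator]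
        refine ⟨x, fun r hr => hp ?_⟩
        rw [Submodule.mem_annihilator_span_singleton] at hr
        exact hr
      rw [hsupp] at hmem
      exact iInf₂_le p hmem
    obtain ⟨n, hn⟩ := Ideal.exists_pow_le_of_le_radical_of_fg hle
      (IsNoetherian.noetherian _)
    have hx : x ∈ Submodule.torsionBySet R M ((⨅ m ∈ s, m ^ n : Ideal R) : Set R) := by
      rw [Submodule.mem_torsionBySet_iff]
      rintro ⟨r, hr⟩
      have h1 : (⨅ m ∈ s, m ^ n : Ideal R) ≤ (⨅ m ∈ s, m : Ideal R) ^ n := by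
        rw [← Ideal.prod_eq_iInf_of_pairwise_isCoprime (J := fun m : Ideal R => m ^ n)
          (fun i hi j hj hij => Ideal.isCoprime_iff_sup_eq.mpr (hcop n hi hj hij)),
          Finset.prod_pow, ← Finset.inf_eq_iInf]
        exact Ideal.pow_right_mono Ideal.prod_le_inf n
      exact hn (h1 hr)
    rw [← Submodule.iSup_torsionBySet_ideal_eq_torsionBySet_iInf (hcop n)] at hx
    revert hx
    apply SetLike.le_def.mp
    refine iSup₂_le fun m hm => ?_
    exact le_iSup_of_le (⟨m, hm⟩ : s) (le_iSup_of_le n le_rfl)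
end

section
/- Let (R, m) be a complete Noetherian local ring and M an Artinian R-module. Then Ann_R(0 :_M p) = p for every prime ideal p of R containing Ann_R(M). -/
namespace AnnTorsion

open IsLocalRing

universe u v

theorem exists_hull_aux (R : Type u) [CommRing R] [IsLocalRing R]
    (E0 : Type u) [AddCommGroup E0] [Module R E0] (hB : Module.Baer R E0)
    (s : E0) (hs0 : s ≠ 0) (hsm : ∀ r ∈ maximalIdeal R, r • s = 0) :
    ∃ (E : Type u) (_ : AddCommGroup E) (_ : Module R E) (s : E), Module.Baer R E ∧ s ≠ 0 ∧
      (∀ r ∈ maximalIdeal R, r • s = 0) ∧ ∀ x : E, x ≠ 0 → ∃ r : R, r • x = s := by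
  obtain ⟨F, hsF, hF⟩ := zorn_le_nonempty₀
    {F : Submodule R E0 | ∀ x ∈ F, x ≠ 0 → ∃ r : R, r • x = s} (by
      intro c hc hch y hy
      refine ⟨sSup c, ?_, fun z hz => le_sSup hz⟩
      intro x hx hx0
      rw [Submodule.mem_sSup_of_directed ⟨y, hy⟩ hch.directedOn] at hx
      obtain ⟨G, hG, hxG⟩ := hx
      exact hc hG x hxG hx0) (Submodule.span R {s}) (by
      intro x hx hx0
      obtain ⟨r, rfl⟩ := Submodule.mem_span_singleton.mp hx
      have hr : IsUnit r := by
        by_contra h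
        exact hx0 (hsm r ((mem_maximalIdeal r).mpr h))
      obtain ⟨w, rfl⟩ := hr
      exact ⟨(↑w⁻¹ : R), by simp [smul_smul]⟩)
  have hsF : s ∈ F := hsF (Submodule.mem_span_singleton_self s)
  obtain ⟨C, -, hC⟩ := zorn_le_nonempty₀ {C : Submodule R E0 | Disjoint F C} (by
      intro c hc hch y hy
      exact ⟨sSup c, hch.directedOn.disjoint_sSup_right.mpr (fun b hb => hc hb),
        fun z hz => le_sSup hz⟩) ⊥ disjoint_bot_right
  have hu : Function.Injective (C.mkQ ∘ₗ F.subtype) := by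
    rw [← LinearMap.ker_eq_bot, LinearMap.ker_eq_bot']
    intro x hx
    have hxC : (x : E0) ∈ C := by simpa using hx
    exact Subtype.ext (Submodule.disjoint_def.mp hC.prop _ x.2 hxC)
  obtain ⟨j, hj⟩ := hB.extension_property _ hu F.subtype
  have hjF : ∀ f ∈ F, j (C.mkQ f) = f := fun f hf => DFunLike.congr_fun hj (⟨f, hf⟩ : F)
  have key : ∀ y, y ≠ 0 → ∃ r : R, r • j y = s := by
    intro y hy
    obtain ⟨e, rfl⟩ := C.mkQ_surjective y
    have he : e ∉ C := by simpa using hy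
    have hnd : ¬ Disjoint F (C ⊔ Submodule.span R {e}) := by
      intro hd
      have := hC.le_of_ge hd le_sup_left
      exact he (this (Submodule.mem_sup_right (Submodule.mem_span_singleton_self e)))
    rw [Submodule.disjoint_def] at hnd
    push Not at hnd
    obtain ⟨f, hfF, hf, hf0⟩ := hnd
    obtain ⟨c, hc, z, hz, hcz⟩ := Submodule.mem_sup.mp hf
    obtain ⟨r, rfl⟩ := Submodule.mem_span_singleton.mp hz
    obtain ⟨r', hr'⟩ := hF.prop f hfF hf0
    refine ⟨r' * r, ?_⟩
    have h1 : C.mkQ f = r • C.mkQ e := by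
      have : C.mkQ c = 0 := by simpa using hc
      rw [← hcz, map_add, this, zero_add, map_smul]
    rw [mul_smul, ← map_smul, ← h1, hjF f hfF, hr']
  have hrange : LinearMap.range j ≤ F := by
    refine hF.le_of_ge ?_ ?_
    · rintro _ ⟨y, rfl⟩ hy
      exact key y (fun h => hy (by rw [h, map_zero]))
    · intro f hf
      exact ⟨_, hjF f hf⟩
  refine ⟨F, inferInstance, inferInstance, ⟨s, hsF⟩, ?_, ?_, ?_, ?_⟩
  · intro I g
    obtain ⟨g', hg'⟩ := hB I (F.subtype ∘ₗ g)
    refine ⟨(j.codRestrict F (fun y => hrange ⟨y, rfl⟩)) ∘ₗ C.mkQ ∘ₗ g', ?_⟩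
    intro x hx
    apply Subtype.ext
    have := hg' x hx
    change j (C.mkQ (g' x)) = _
    rw [this]
    exact hjF _ (g ⟨x, hx⟩).2
  · intro h
    exact hs0 (congrArg Subtype.val h)
  · intro r hr
    exact Subtype.ext (hsm r hr)
  · intro x hx
    obtain ⟨r, hr⟩ := hF.prop x x.2 (fun h => hx (Subtype.ext h))
    exact ⟨r, Subtype.ext hr⟩

/-- Existence of an injective module which is an essential extension of the residue field. -/
theorem exists_hull (R : Type u) [CommRing R] [IsLocalRing R] :
    ∃ (E : Type u) (_ : AddCommGroup E) (_ : Module R E) (s : E), Module.Baer R E ∧ s ≠ 0 ∧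
      (∀ r ∈ maximalIdeal R, r • s = 0) ∧ ∀ x : E, x ≠ 0 → ∃ r : R, r • x = s := by
  have hB : Module.Baer R (CharacterModule R) :=
    Module.Flat.iff_characterModule_baer.mp inferInstance
  obtain ⟨s, hs0, hsm⟩ : ∃ s : CharacterModule R, s ≠ 0 ∧ ∀ r ∈ maximalIdeal R, r • s = 0 := by
    obtain ⟨c, hc⟩ := CharacterModule.exists_character_apply_ne_zero_of_ne_zero
      (one_ne_zero : (1 : R ⧸ maximalIdeal R) ≠ 0)
    refine ⟨CharacterModule.dual (maximalIdeal R).mkQ c, ?_, ?_⟩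
    · intro h
      apply hc
      exact DFunLike.congr_fun h (1 : R)
    · intro r hr
      ext x
      have h1 : (maximalIdeal R).mkQ (r • x) = 0 := by
        rw [Submodule.mkQ_apply, Submodule.Quotient.mk_eq_zero]
        exact Ideal.mul_mem_right _ _ hr
      change c ((maximalIdeal R).mkQ (r • x)) = 0
      rw [h1, map_zero]
  exact exists_hull_aux R (CharacterModule R) hB s hs0 hsm

section

variable {R : Type*} [CommRing R]

theorem factor {A B E : Type*} [AddCommGroup A] [Module R A] [AddCommGroup B] [Module R B]
    [AddCommGroup E] [Module R E] (hB : Module.Baer R E) (a : A →ₗ[R] B) (b : A →ₗ[R] E)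
    (h : LinearMap.ker a ≤ LinearMap.ker b) : ∃ w : B →ₗ[R] E, ∀ x, w (a x) = b x := by
  have hi : Function.Injective ((LinearMap.ker a).liftQ a le_rfl) := by
    rw [← LinearMap.ker_eq_bot]
    exact Submodule.ker_liftQ_eq_bot _ _ _ le_rfl
  obtain ⟨w, hw⟩ := hB.extension_property _ hi ((LinearMap.ker a).liftQ b h)
  refine ⟨w, fun x => ?_⟩
  exact DFunLike.congr_fun hw ((LinearMap.ker a).mkQ x)

theorem mem_smul_of_vanish {M E : Type*} [AddCommGroup M] [Module R M]
    [AddCommGroup E] [Module R E] (hB : Module.Baer R E) (I : Ideal R) (hI : I.FG)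
    (f : M →ₗ[R] E) (hf : ∀ x : M, (∀ a ∈ I, a • x = 0) → f x = 0) :
    f ∈ I • (⊤ : Submodule R (M →ₗ[R] E)) := by
  classical
  obtain ⟨t, ht⟩ := hI
  obtain ⟨w, hw⟩ := factor hB
    (LinearMap.pi (fun i : t => (i : R) • (LinearMap.id : M →ₗ[R] M))) f (by
      intro x hx
      refine hf x ?_
      have h1 : I ≤ LinearMap.ker (LinearMap.toSpanSingleton R M x) := by
        rw [← ht, Ideal.span, Submodule.span_le]
        intro a ha
        exact congrFun hx (⟨a, ha⟩ : t)
      intro a ha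
      exact h1 ha)
  have : f = ∑ i : t, (i : R) • (w ∘ₗ LinearMap.single R (fun _ : t => M) i) := by
    ext x
    rw [← hw x, ← LinearMap.sum_single_apply (fun _ : t => M)
      (LinearMap.pi (fun i : t => (i : R) • (LinearMap.id : M →ₗ[R] M)) x), map_sum]
    simp only [LinearMap.sum_apply, LinearMap.smul_apply, LinearMap.comp_apply]
    refine Finset.sum_congr rfl fun i _ => ?_
    rw [← map_smul, ← map_smul]
    rfl
  rw [this]
  refine Submodule.sum_mem _ fun i _ => Submodule.smul_mem_smul ?_ trivial
  rw [← ht]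
  exact Ideal.subset_span i.2

theorem pi_precomplete (I : Ideal R) [IsPrecomplete I R] (n : ℕ) :
    IsPrecomplete I (Fin n → R) := by
  constructor
  intro f hf
  have hmem : ∀ k (x : Fin n → R),
      x ∈ (I ^ k • ⊤ : Submodule R (Fin n → R)) ↔ ∀ i, x i ∈ (I ^ k • ⊤ : Submodule R R) := by
    intro k x
    constructor
    · intro hx i
      have := Submodule.mem_map_of_mem (f := LinearMap.proj (R := R) (φ := fun _ : Fin n => R) i) hx
      rw [Submodule.map_smul''] at this
      exact Submodule.smul_mono le_rfl le_top this
    · intro hx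
      rw [pi_eq_sum_univ x]
      refine Submodule.sum_mem _ fun i _ => Submodule.smul_mem_smul ?_ trivial
      simpa using hx i
  choose L hL using fun i => IsPrecomplete.prec (I := I) (M := R) inferInstance
    (f := fun k => f k i) (fun {a b} hab => by
      have := hf hab
      rw [SModEq.sub_mem, hmem] at this
      rw [SModEq.sub_mem]
      exact this i)
  refine ⟨L, fun k => ?_⟩
  rw [SModEq.sub_mem, hmem]
  intro i
  exact SModEq.sub_mem.mp (hL i k)

theorem finite_of_quot (I : Ideal R) [IsPrecomplete I R] (D : Type*) [AddCommGroup D] [Module R D]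
    [IsHausdorff I D] (h : Module.Finite R (D ⧸ (I • ⊤ : Submodule R D))) : Module.Finite R D := by
  obtain ⟨n, f, hf⟩ := Module.Finite.exists_fin' R (D ⧸ (I • ⊤ : Submodule R D))
  obtain ⟨g, hg⟩ := Module.projective_lifting_property (Submodule.mkQ (I • ⊤ : Submodule R D)) f
    (Submodule.mkQ_surjective _)
  have := pi_precomplete I n
  exact Module.Finite.of_surjective g
    (surjective_of_mkQ_comp_surjective (I := I) (by rw [hg]; exact hf))

end

section

variable {R : Type*} [CommRing R] [IsLocalRing R] [IsNoetherianRing R]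

theorem torsion {M : Type*} [AddCommGroup M] [Module R M] [IsArtinian R M] (x : M) :
    ∃ n : ℕ, ∀ r ∈ maximalIdeal R ^ n, r • x = 0 := by
  let N : ℕ → Submodule R M := fun n => maximalIdeal R ^ n • Submodule.span R {x}
  obtain ⟨n, hn⟩ := IsArtinian.monotone_stabilizes (R := R) (M := M)
    ⟨fun n => OrderDual.toDual (N n), fun a b hab =>
      Submodule.smul_mono_left (Ideal.pow_le_pow_right hab)⟩
  have h1 : N n = N (n + 1) := hn (n + 1) (Nat.le_succ n)
  have hfg : (N n).FG := Submodule.FG.smul (IsNoetherian.noetherian _)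
    (Submodule.fg_span_singleton x)
  have h0 : N n = ⊥ := by
    refine Submodule.eq_bot_of_le_smul_of_le_jacobson_bot (maximalIdeal R) _ hfg ?_
      (maximalIdeal_le_jacobson _)
    refine h1.le.trans ?_
    simp only [N]
    rw [pow_succ', mul_smul]
  refine ⟨n, fun r hr => ?_⟩
  have : r • x ∈ N n := Submodule.smul_mem_smul hr (Submodule.mem_span_singleton_self x)
  rw [h0] at this
  exact this

theorem socle_finite (M : Type*) [AddCommGroup M] [Module R M] [IsArtinian R M] :
    (Submodule.torsionBySet R M (maximalIdeal R : Set R)).FG := by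
  have htor := Submodule.torsionBySet_isTorsionBySet (R := R) (M := M) (maximalIdeal R : Set R)
  letI : Field (R ⧸ maximalIdeal R) := Ideal.Quotient.field _
  letI := htor.module
  have hss : IsSemisimpleModule R (Submodule.torsionBySet R M (maximalIdeal R : Set R)) :=
    htor.isSemisimpleModule_iff.mp inferInstance
  have hfin : Module.Finite R (Submodule.torsionBySet R M (maximalIdeal R : Set R)) :=
    ((IsSemisimpleModule.finite_tfae (R := R)
      (M := Submodule.torsionBySet R M (maximalIdeal R : Set R))).out 0 2).mpr
      (inferInstance : IsArtinian R _)
  exact Module.Finite.iff_fg.mp hfin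

theorem dual_finite [IsPrecomplete (maximalIdeal R) R] {M E : Type*} [AddCommGroup M] [Module R M]
    [IsArtinian R M] [AddCommGroup E] [Module R E] (hB : Module.Baer R E) (s : E)
    (hs : ∀ x : E, x ≠ 0 → ∃ r : R, r • x = s) (hs0 : s ≠ 0) :
    Module.Finite R (M →ₗ[R] E) := by
  have hH : IsHausdorff (maximalIdeal R) (M →ₗ[R] E) := by
    constructor
    intro f hf
    ext x
    obtain ⟨n, hn⟩ := torsion (R := R) x
    have h1 := hf n
    rw [SModEq.zero] at h1
    have : (maximalIdeal R ^ n • ⊤ : Submodule R (M →ₗ[R] E)) ≤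
        LinearMap.ker (LinearMap.applyₗ (R := R) (M₂ := E) x) := by
      rw [Submodule.smul_le]
      intro r hr g _
      change r • g x = 0
      rw [← map_smul, hn r hr, map_zero]
    exact this h1
  apply finite_of_quot (maximalIdeal R)
  obtain ⟨t, ht⟩ := socle_finite (R := R) M
  -- socle of `E`
  have hsoc : ∀ x : E, (∀ r ∈ maximalIdeal R, r • x = 0) → x ∈ Submodule.span R {s} := by
    intro x hx
    by_cases hx0 : x = 0
    · rw [hx0]; exact zero_mem _
    obtain ⟨r, hr⟩ := hs x hx0
    have hu : IsUnit r := by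
      by_contra h
      exact hs0 (by rw [← hr, hx r ((mem_maximalIdeal r).mpr h)])
    obtain ⟨w, rfl⟩ := hu
    exact Submodule.mem_span_singleton.mpr ⟨(↑w⁻¹ : R), by rw [← hr]; simp [smul_smul]⟩
  have htm : ∀ i : t, ∀ r ∈ maximalIdeal R, r • (i : M) = 0 := by
    intro i r hr
    have : (i : M) ∈ Submodule.torsionBySet R M (maximalIdeal R : Set R) := by
      rw [← ht]; exact Submodule.subset_span i.2
    exact (Submodule.mem_torsionBySet_iff _ _).mp this ⟨r, hr⟩
  let ev : (M →ₗ[R] E) →ₗ[R] (t → Submodule.span R {s}) :=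
    LinearMap.pi fun i => (LinearMap.applyₗ (R := R) (M₂ := E) (i : M)).codRestrict _ (fun f =>
      hsoc _ fun r hr => by
        change r • f i = 0
        rw [← map_smul, htm i r hr, map_zero])
  have hker : LinearMap.ker ev ≤ (maximalIdeal R • ⊤ : Submodule R (M →ₗ[R] E)) := by
    intro f hf
    refine mem_smul_of_vanish hB _ (IsNoetherian.noetherian _) f ?_
    intro x hx
    have hxt : x ∈ Submodule.torsionBySet R M (maximalIdeal R : Set R) :=
      (Submodule.mem_torsionBySet_iff _ _).mpr fun a => hx a a.2
    rw [← ht] at hxt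
    have : Submodule.span R (t : Set M) ≤ LinearMap.ker f := by
      rw [Submodule.span_le]
      intro i hi
      exact congrArg Subtype.val (congrFun hf (⟨i, hi⟩ : t))
    exact this hxt
  have hfin : Module.Finite R ((M →ₗ[R] E) ⧸ LinearMap.ker ev) :=
    Module.Finite.equiv ev.quotKerEquivRange.symm
  exact Module.Finite.of_surjective (Submodule.factor hker) (Submodule.factor_surjective hker)

end

end AnnTorsion

/-- Let `(R, m)` be a complete Noetherian local ring and `M` an Artinian
`R`-module. Then `Ann_R(0 :_M p) = p` for every prime ideal `p ⊇ Ann_R(M)`. -/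
theorem annihilator_torsionBySet_eq_of_complete_local
    (R M : Type*) [CommRing R] [IsNoetherianRing R] [IsLocalRing R]
    [IsAdicComplete (IsLocalRing.maximalIdeal R) R]
    [AddCommGroup M] [Module R M] [IsArtinian R M] :
    ∀ p : Ideal R, p.IsPrime → Module.annihilator R M ≤ p →
      (Submodule.torsionBySet R M (p : Set R)).annihilator = p := by
  intro p hp hM
  apply le_antisymm
  swap
  · intro r hr
    rw [Submodule.mem_annihilator]
    intro x hx
    exact (Submodule.mem_torsionBySet_iff _ _).mp hx ⟨r, hr⟩
  intro r hr
  rw [Submodule.mem_annihilator] at hr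
  obtain ⟨E, _, _, s, hB, hs0, hsm, hs⟩ := AnnTorsion.exists_hull R
  have hfin : Module.Finite R (M →ₗ[R] E) := AnnTorsion.dual_finite hB s hs hs0
  obtain ⟨P, hP, -, hcoeff, hP0⟩ :=
    LinearMap.exists_monic_and_natDegree_eq_and_coeff_mem_pow_and_aeval_eq_zero
    R (algebraMap R (Module.End R (M →ₗ[R] E)) r) p (by
      rintro _ ⟨f, rfl⟩
      refine AnnTorsion.mem_smul_of_vanish hB p (IsNoetherian.noetherian _) _ ?_
      intro x hx
      change r • f x = 0
      rw [← map_smul, hr x ((Submodule.mem_torsionBySet_iff _ _).mpr fun a => hx a a.2), map_zero])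
  rw [Polynomial.aeval_algebraMap_apply] at hP0
  -- `P(r)` kills `M`
  have hPM : P.eval r ∈ Module.annihilator R M := by
    rw [Module.mem_annihilator]
    intro x
    by_contra hx
    obtain ⟨w, hw⟩ := AnnTorsion.factor hB (LinearMap.toSpanSingleton R M (P.eval r • x))
      (LinearMap.toSpanSingleton R E s) (by
        intro a ha
        refine hsm a ((IsLocalRing.mem_maximalIdeal a).mpr fun hu => hx ?_)
        exact (hu.smul_eq_zero).mp ha)
    have h1 := hw 1
    have h2 := LinearMap.congr_fun (LinearMap.congr_fun hP0 w) x
    rw [Polynomial.coe_aeval_eq_eval] at h2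
    have h3 : P.eval r • w x = 0 := h2
    rw [LinearMap.toSpanSingleton_apply, LinearMap.toSpanSingleton_apply, one_smul, one_smul,
      map_smul, h3] at h1
    exact hs0 h1.symm
  have hPp := hM hPM
  rw [Polynomial.eval_eq_sum_range, Finset.sum_range_succ] at hPp
  have hlow : ∑ i ∈ Finset.range P.natDegree, P.coeff i * r ^ i ∈ p := by
    refine Ideal.sum_mem _ fun i hi => Ideal.mul_mem_right _ _ ?_
    have hi' := Finset.mem_range.mp hi
    exact Ideal.pow_le_self (by omega) (hcoeff i)
  have hlast := (Ideal.add_mem_iff_right p hlow).mp hPp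
  rw [hP.coeff_natDegree, one_mul] at hlast
  exact hp.mem_of_pow_mem _ hlast
end

section
/- Let R be a Noetherian ring and M an Artinian R-module. Then the sets Att_R(M), Cos_R(M), and V(Ann_R(M)) have the same minimal elements. -/
/-- `p` is an attached prime of `M` iff `p` is prime and is the annihilator of some quotient
of `M`. -/
def IsAttachedPrime (R : Type*) [CommRing R] (M : Type*) [AddCommGroup M] [Module R M]
    (p : Ideal R) : Prop :=
  p.IsPrime ∧ ∃ N : Submodule R M, Module.annihilator R (M ⧸ N) = p

/-- The co-support of an `R`-module `N`, as a set of prime ideals. -/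
def coSupportIdeals (R : Type*) [CommRing R] (N : Type*) [AddCommGroup N] [Module R N] :
    Set (Ideal R) :=
  {p | ∃ _ : p.IsPrime, Nontrivial (Localization.AtPrime p →ₗ[R] N)}

/-- A directed family of nonempty affine subspaces of an Artinian module has a least member. -/
lemma aff_least {R M : Type*} [CommRing R] [AddCommGroup M] [Module R M] [IsArtinian R M]
    (A : Set (AffineSubspace R M)) (hA : A.Nonempty) (hne : ∀ B ∈ A, (B : Set M).Nonempty)
    (hdir : ∀ B ∈ A, ∀ C ∈ A, ∃ D ∈ A, D ≤ B ∧ D ≤ C) : ∃ B ∈ A, ∀ C ∈ A, B ≤ C := by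
  obtain ⟨_, ⟨B, hB, rfl⟩, hmin⟩ := IsArtinian.set_has_minimal
    (AffineSubspace.direction '' A) (hA.image _)
  refine ⟨B, hB, fun C hC => ?_⟩
  obtain ⟨D, hD, hDB, hDC⟩ := hdir B hB C hC
  have h1 : D.direction = B.direction := by
    by_contra h
    exact hmin _ ⟨D, hD, rfl⟩ (lt_of_le_of_ne (AffineSubspace.direction_le hDB) h)
  rw [← AffineSubspace.eq_of_direction_eq_of_nonempty_of_le h1 (hne D hD) hDB]
  exact hDC

/-- Compatible families of nonempty affine subspaces indexed by a submonoid. -/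
def CompatFam {R M : Type*} [CommRing R] [AddCommGroup M] [Module R M] (S : Submonoid R)
    (F : S → AffineSubspace R M) : Prop :=
  (∀ s, (F s : Set M).Nonempty) ∧ ∀ s t : S, ∀ y ∈ F (s * t), (t : R) • y ∈ F s

lemma exists_minimal_fam {R M : Type*} [CommRing R] [AddCommGroup M] [Module R M] [IsArtinian R M]
    (S : Submonoid R) (F₀ : S → AffineSubspace R M) (h₀ : CompatFam S F₀) :
    ∃ F, F ≤ F₀ ∧ Minimal (CompatFam S) F := by
  refine @zorn_le_nonempty₀ (S → AffineSubspace R M)ᵒᵈ _ {F | CompatFam S F} ?_ F₀ h₀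
  intro c hc hch G hG
  have hc' : ∀ F : S → AffineSubspace R M, F ∈ c → CompatFam S F := fun F hF => hc hF
  let L : S → AffineSubspace R M := fun s => sInf ((fun F : S → AffineSubspace R M => F s) '' c)
  have hmem : ∀ s y, y ∈ L s ↔ ∀ F : S → AffineSubspace R M, F ∈ c → y ∈ F s := by
    intro s y
    simp only [L, AffineSubspace.mem_sInf_iff]
    constructor
    · intro h F hF
      exact h _ ⟨F, hF, rfl⟩
    · rintro h _ ⟨F, hF, rfl⟩
      exact h F hF
  refine ⟨L, ⟨?_, ?_⟩, ?_⟩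
  · intro s
    obtain ⟨B, ⟨F, hF, rfl⟩, hB⟩ := aff_least
      ((fun F : S → AffineSubspace R M => F s) '' c) ⟨_, G, hG, rfl⟩
      (by rintro _ ⟨F, hF, rfl⟩; exact (hc' F hF).1 s)
      (by
        rintro _ ⟨F, hF, rfl⟩ _ ⟨F', hF', rfl⟩
        rcases hch.total hF hF' with h | h
        · exact ⟨_, ⟨F', hF', rfl⟩, h s, le_rfl⟩
        · exact ⟨_, ⟨F, hF, rfl⟩, le_rfl, h s⟩)
    obtain ⟨y, hy⟩ := (hc' F hF).1 s
    exact ⟨y, (hmem s y).2 fun F' hF' => hB _ ⟨F', hF', rfl⟩ hy⟩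
  · intro s t y hy
    rw [hmem] at hy ⊢
    exact fun F hF => (hc' F hF).2 s t y (hy F hF)
  · intro F hF s y hy
    exact (hmem s y).1 hy F hF

/-- The inverse limit of nonempty affine subspaces is nonempty. -/
lemma exists_section {R M : Type*} [CommRing R] [AddCommGroup M] [Module R M] [IsArtinian R M]
    (S : Submonoid R) (F₀ : S → AffineSubspace R M) (h₀ : CompatFam S F₀) :
    ∃ f : S → M, (∀ s, f s ∈ F₀ s) ∧ ∀ s t : S, (t : R) • f (s * t) = f s := by
  obtain ⟨F, hF, ⟨hne, hco⟩, hmin⟩ := exists_minimal_fam S F₀ h₀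
  -- surjectivity
  have hsurj : ∀ s t : S, ∀ x ∈ F s, ∃ y ∈ F (s * t), (t : R) • y = x := by
    let I : S → S → AffineSubspace R M := fun s t =>
      (F (s * t)).map (LinearMap.toAffineMap ((t : R) • (LinearMap.id : M →ₗ[R] M)))
    have hI : ∀ s t x, x ∈ I s t ↔ ∃ y ∈ F (s * t), (t : R) • y = x := by
      intro s t x
      simp [I, AffineSubspace.mem_map]
    let G : S → AffineSubspace R M := fun s => ⨅ t, I s t
    have hG : ∀ s x, x ∈ G s ↔ ∀ t, ∃ y ∈ F (s * t), (t : R) • y = x := by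
      intro s x
      simp only [G, AffineSubspace.mem_iInf_iff, hI]
    have hGF : G ≤ F := by
      intro s x hx
      obtain ⟨y, hy, rfl⟩ := (hG s x).1 hx 1
      exact hco s 1 y hy
    have hGc : CompatFam S G := by
      constructor
      · intro s
        obtain ⟨B, ⟨t, rfl⟩, hB⟩ := aff_least (Set.range (I s)) ⟨_, 1, rfl⟩
          (by
            rintro _ ⟨t, rfl⟩
            obtain ⟨y, hy⟩ := hne (s * t)
            exact ⟨(t : R) • y, (hI _ _ _).2 ⟨y, hy, rfl⟩⟩)
          (by
            rintro _ ⟨t, rfl⟩ _ ⟨u, rfl⟩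
            refine ⟨_, ⟨t * u, rfl⟩, ?_, ?_⟩
            · intro x hx
              obtain ⟨y, hy, rfl⟩ := (hI _ _ _).1 hx
              refine (hI _ _ _).2 ⟨(u : R) • y, hco _ _ _ (by rwa [mul_assoc]), ?_⟩
              rw [smul_smul]; rfl
            · intro x hx
              obtain ⟨y, hy, rfl⟩ := (hI _ _ _).1 hx
              refine (hI _ _ _).2 ⟨(t : R) • y, hco _ _ _ (by rwa [mul_assoc, mul_comm u]), ?_⟩
              rw [smul_smul, mul_comm]; rfl)
        obtain ⟨y, hy⟩ := hne (s * t)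
        refine ⟨(t : R) • y, (hG _ _).2 fun u => ?_⟩
        exact (hI _ _ _).1 (hB _ ⟨u, rfl⟩ ((hI _ _ _).2 ⟨y, hy, rfl⟩))
      · intro s t x hx
        rw [hG] at hx ⊢
        intro u
        obtain ⟨y, hy, rfl⟩ := hx u
        refine ⟨(t : R) • y, hco _ _ _ (by rwa [mul_right_comm]), smul_comm _ _ _⟩
    intro s t x hx
    exact (hG s x).1 (hmin hGc hGF s hx) t
  -- uniqueness
  have huniq : ∀ s₀ : S, ∀ x ∈ F s₀, ∀ x' ∈ F s₀, x' = x := by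
    intro s₀ x hx
    let G : S → AffineSubspace R M := fun s =>
      { carrier := {y | ∃ z ∈ F (s * s₀), (s₀ : R) • z = y ∧ (s : R) • z = x}
        smul_vsub_vadd_mem' := by
          rintro c _ _ _ ⟨z₁, h₁, rfl, e₁⟩ ⟨z₂, h₂, rfl, e₂⟩ ⟨z₃, h₃, rfl, e₃⟩
          refine ⟨_, (F (s * s₀)).smul_vsub_vadd_mem c h₁ h₂ h₃, ?_, ?_⟩
          · simp only [vsub_eq_sub, vadd_eq_add, smul_add, smul_sub, smul_comm c]
          · simp only [vsub_eq_sub, vadd_eq_add, smul_add, smul_comm _ c, smul_sub, e₁, e₂, e₃]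
            simp }
    have hG : ∀ s y, y ∈ G s ↔ ∃ z ∈ F (s * s₀), (s₀ : R) • z = y ∧ (s : R) • z = x :=
      fun s y => Iff.rfl
    have hGF : G ≤ F := by
      intro s y hy
      obtain ⟨z, hz, rfl, -⟩ := (hG s y).1 hy
      exact hco _ _ _ hz
    have hGc : CompatFam S G := by
      constructor
      · intro s
        obtain ⟨z, hz, e⟩ := hsurj s₀ s x hx
        exact ⟨(s₀ : R) • z, (hG _ _).2 ⟨z, by rwa [mul_comm], rfl, e⟩⟩
      · intro s t y hy
        obtain ⟨z, hz, rfl, e⟩ := (hG _ _).1 hy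
        refine (hG _ _).2 ⟨(t : R) • z, hco _ _ _ (by rwa [mul_right_comm]), smul_comm _ _ _, ?_⟩
        rw [smul_smul]; exact e
    intro x' hx'
    obtain ⟨z, -, h1, h2⟩ := (hG _ _).1 (hmin hGc hGF s₀ hx')
    exact h1.symm.trans h2
  choose f hf using hne
  exact ⟨f, fun s => hF s (hf s), fun s t => huniq s _ (hf s) _ (hco _ _ _ (hf _))⟩

lemma exists_hom {R M : Type*} [CommRing R] [AddCommGroup M] [Module R M]
    (S : Submonoid R) (f : S → M) (hf : ∀ s t : S, (t : R) • f (s * t) = f s) :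
    ∃ g : Localization S →ₗ[R] M, g 1 = f 1 := by
  have key : ∀ (r : R) (s : S) (r' : R) (s' : S),
      Localization.mk r s = Localization.mk r' s' → r • f s = r' • f s' := by
    intro r s r' s' h
    rw [Localization.mk_eq_mk_iff, Localization.r_iff_exists] at h
    obtain ⟨u, hu⟩ := h
    simp only at hu
    have e1 := hf s (u * s')
    have e2 := hf s' (u * s)
    rw [← e1, ← e2, show s' * (u * s) = s * (u * s') by rw [mul_left_comm, mul_comm s', mul_left_comm],
      smul_smul, smul_smul]
    congr 1
    push_cast
    linear_combination hu
  have hex : ∀ x : Localization S, ∃ y : M, ∀ r s, x = Localization.mk r s → y = r • f s := by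
    intro x
    induction x using Localization.induction_on with
    | H y => exact ⟨y.1 • f y.2, fun r s h => key _ _ _ _ h⟩
  choose g hg using hex
  have hg' : ∀ r s, g (Localization.mk r s) = r • f s := fun r s => hg _ r s rfl
  refine ⟨{ toFun := g, map_add' := ?_, map_smul' := ?_ }, ?_⟩
  · intro x y
    induction x using Localization.induction_on with
    | H x =>
      induction y using Localization.induction_on with
      | H y =>
        rw [Localization.add_mk, hg', hg', hg', ← hf x.2 y.2, ← hf y.2 x.2, mul_comm y.2 x.2,
          smul_smul, smul_smul, ← add_smul]
        congr 1
        ring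
  · intro r x
    induction x using Localization.induction_on with
    | H x =>
      rw [Localization.smul_mk, hg', hg', smul_smul]; rfl
  · change g 1 = _
    rw [← Localization.mk_one, hg', one_smul]

lemma mem_cos {R M : Type*} [CommRing R] [AddCommGroup M] [Module R M] [IsArtinian R M]
    (p : Ideal R) [p.IsPrime] (hp : Module.annihilator R M ≤ p) :
    Nontrivial (Localization.AtPrime p →ₗ[R] M) := by
  obtain ⟨_, ⟨s, rfl⟩, hs⟩ := IsArtinian.set_has_minimal
    (Set.range fun s : p.primeCompl => LinearMap.range ((s : R) • (LinearMap.id : M →ₗ[R] M)))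
    ⟨_, 1, rfl⟩
  have hdiv : ∀ (t : p.primeCompl) (x : M), ∃ y : M, (t : R) • (s : R) • y = (s : R) • x := by
    intro t x
    have hle : LinearMap.range (((s * t : p.primeCompl) : R) • (LinearMap.id : M →ₗ[R] M)) ≤
        LinearMap.range ((s : R) • (LinearMap.id : M →ₗ[R] M)) := by
      rintro _ ⟨y, rfl⟩
      exact ⟨(t : R) • y, by simp [smul_smul, mul_comm]⟩
    have heq := eq_of_le_of_not_lt hle (hs _ ⟨s * t, rfl⟩)
    have hx : (s : R) • x ∈ LinearMap.range ((s : R) • (LinearMap.id : M →ₗ[R] M)) := ⟨x, rfl⟩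
    rw [← heq] at hx
    obtain ⟨y, hy⟩ := hx
    refine ⟨y, ?_⟩
    rw [← hy, smul_smul]
    simp [mul_comm]
  obtain ⟨x, hx⟩ : ∃ x : M, (s : R) • x ≠ 0 := by
    by_contra! h
    exact s.2 (hp (Module.mem_annihilator.2 h))
  obtain ⟨f, hf0, hf⟩ := exists_section p.primeCompl
    (fun t => { carrier := {y : M | (t : R) • y = (s : R) • x}
                smul_vsub_vadd_mem' := by
                  intro c a b d ha hb hd
                  simp only [Set.mem_ofPred_eq] at ha hb hd ⊢
                  simp only [vsub_eq_sub, vadd_eq_add, smul_add, smul_comm _ c, smul_sub,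
                    ha, hb, hd]
                  simp })
    ⟨fun t => let ⟨y, hy⟩ := hdiv t x; ⟨_, hy⟩, fun a b y hy => by
      change (a : R) • (b : R) • y = _
      rw [smul_smul]; exact hy⟩
  obtain ⟨g, hg⟩ := exists_hom _ f hf
  refine ⟨g, 0, fun h => hx ?_⟩
  have h1 : ((1 : p.primeCompl) : R) • f 1 = (s : R) • x := hf0 1
  rw [← h1, ← hg, h]
  simp

lemma ann_le_of_cos {R M : Type*} [CommRing R] [AddCommGroup M] [Module R M]
    (p : Ideal R) [p.IsPrime] (h : Nontrivial (Localization.AtPrime p →ₗ[R] M)) :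
    Module.annihilator R M ≤ p := by
  intro a ha
  by_contra hap
  obtain ⟨g, hg⟩ := exists_ne (0 : Localization.AtPrime p →ₗ[R] M)
  apply hg
  ext x
  have hu : IsUnit (algebraMap R (Localization.AtPrime p) a) :=
    IsLocalization.map_units (M := p.primeCompl) _ ⟨a, hap⟩
  obtain ⟨y, hy⟩ := hu.dvd (a := x)
  rw [hy, ← Algebra.smul_def, map_smul, Module.mem_annihilator.1 ha]
  simp

lemma att_of_minimal {R M : Type*} [CommRing R] [IsNoetherianRing R] [AddCommGroup M] [Module R M]
    (p : Ideal R) (hp : p ∈ (Module.annihilator R M).minimalPrimes) :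
    IsAttachedPrime R M p := by
  have hpp : p.IsPrime := hp.1.1
  refine ⟨hpp, p • ⊤, le_antisymm ?_ ?_⟩
  · set I := Module.annihilator R M with hI
    obtain ⟨s, hs, hsp⟩ : ∃ s, (∀ x ∈ p, s * x ∈ I.radical) ∧ s ∉ p := by
      have hfin : I.minimalPrimes.Finite := I.finite_minimalPrimes_of_isNoetherianRing R
      by_contra! hcon
      have hle : (hfin.toFinset.erase p).inf id ≤ p := by
        intro s hs
        apply hcon s
        intro x hx
        rw [← Ideal.sInf_minimalPrimes, Ideal.mem_sInf]
        intro q hq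
        by_cases hqp : q = p
        · subst hqp; exact q.mul_mem_left _ hx
        · refine q.mul_mem_right _ ?_
          exact (Finset.inf_le (f := id) (by simp [hqp, hq]) : _ ≤ id q) hs
      obtain ⟨q, hq, hqp⟩ := (Ideal.IsPrime.inf_le' hpp).1 hle
      simp only [Finset.mem_erase, Set.Finite.mem_toFinset, id] at hq hqp
      exact hq.1 (le_antisymm hqp (hp.2 hq.2.1 hqp))
    obtain ⟨n, hn⟩ := Ideal.exists_pow_le_of_le_radical_of_fg
      (I := Ideal.span {s} * p) (J := I)
      (by
        rw [Ideal.span_singleton_mul_le_iff]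
        exact hs) (IsNoetherian.noetherian _)
    intro a ha
    have ha' : ∀ m : M, a • m ∈ (p • ⊤ : Submodule R M) := by
      intro m
      have := Module.mem_annihilator.1 ha (Submodule.Quotient.mk m)
      rwa [← Submodule.Quotient.mk_smul, Submodule.Quotient.mk_eq_zero] at this
    have hstep : ∀ m : M, (s * a) • m ∈ ((Ideal.span {s} * p) • ⊤ : Submodule R M) := by
      intro m
      rw [Submodule.mul_smul, mul_smul s a m]
      exact Submodule.smul_mem_smul (Ideal.mem_span_singleton_self s) (ha' m)
    have hpow : ∀ (k : ℕ) (m : M),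
        (s * a) ^ k • m ∈ ((Ideal.span {s} * p) ^ k • ⊤ : Submodule R M) := by
      intro k
      induction k with
      | zero => intro m; simp
      | succ k ih =>
        intro m
        rw [pow_succ' (Ideal.span {s} * p), Submodule.mul_smul (Ideal.span {s} * p), pow_succ,
          mul_smul ((s * a) ^ k) (s * a) m]
        have h2 := hstep m
        have : ∀ z ∈ ((Ideal.span {s} * p) • ⊤ : Submodule R M), (s * a) ^ k • z ∈
            ((Ideal.span {s} * p) • ((Ideal.span {s} * p) ^ k • ⊤) : Submodule R M) := by
          intro z hz
          induction hz using Submodule.smul_induction_on' with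
          | smul r hr n hn =>
            rw [smul_comm _ r n]
            exact Submodule.smul_mem_smul hr (ih n)
          | add x hx y hy h1 h2 => rw [smul_add]; exact add_mem h1 h2
        exact this _ h2
    have hmem : (s * a) ^ n ∈ I := by
      rw [hI, Module.mem_annihilator]
      intro m
      have h3 : ((Ideal.span {s} * p) ^ n • ⊤ : Submodule R M) ≤ ⊥ := by
        rw [Submodule.smul_le]
        intro r hr z _
        exact (Submodule.mem_bot R).2 (Module.mem_annihilator.1 (hn hr) z)
      exact (Submodule.mem_bot R).1 (h3 (hpow n m))
    exact (hpp.mem_or_mem (hpp.mem_of_pow_mem _ (hp.1.2 hmem))).resolve_left hsp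
  · intro a ha
    rw [Module.mem_annihilator]
    intro x
    obtain ⟨m, rfl⟩ := Submodule.Quotient.mk_surjective _ x
    rw [← Submodule.Quotient.mk_smul, Submodule.Quotient.mk_eq_zero]
    exact Submodule.smul_mem_smul ha trivial

lemma minimal_eq {R : Type*} [CommRing R] (I : Ideal R) (A : Set (Ideal R))
    (h1 : ∀ p ∈ A, p.IsPrime ∧ I ≤ p) (h2 : ∀ p ∈ I.minimalPrimes, p ∈ A) :
    {p : Ideal R | Minimal (· ∈ A) p} =
      {p : Ideal R | Minimal (· ∈ {q : Ideal R | q.IsPrime ∧ I ≤ q}) p} := by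
  ext p
  constructor
  · intro hp
    have := (h1 p hp.1).1
    obtain ⟨q, hq, hqp⟩ := Ideal.exists_minimalPrimes_le (h1 p hp.1).2
    have : q = p := le_antisymm hqp (hp.2 (h2 q hq) hqp)
    subst this
    exact hq
  · intro hp
    exact ⟨h2 p hp, fun q hq hqp => hp.2 (h1 q hq) hqp⟩

/-- Let `R` be a Noetherian ring and `M` an Artinian `R`-module. Then
`Att_R(M)`, `Cos_R(M)` and `V(Ann_R M)` have the same minimal elements. -/
theorem att_cos_vann_same_minimal_elements
    (R M : Type*) [CommRing R] [IsNoetherianRing R]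
    [AddCommGroup M] [Module R M] [IsArtinian R M] :
    {p : Ideal R | Minimal (· ∈ {q | IsAttachedPrime R M q}) p}
        = {p : Ideal R | Minimal (· ∈ coSupportIdeals R M) p} ∧
    {p : Ideal R | Minimal (· ∈ coSupportIdeals R M) p}
        = {p : Ideal R | Minimal
            (· ∈ {q : Ideal R | q.IsPrime ∧ Module.annihilator R M ≤ q}) p} := by
  have hc := minimal_eq (Module.annihilator R M) (coSupportIdeals R M)
    (fun p ⟨h, h'⟩ => ⟨h, ann_le_of_cos p h'⟩)
    (fun p hp => by
      have : p.IsPrime := hp.1.1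
      exact ⟨hp.1.1, mem_cos p hp.1.2⟩)
  have ha := minimal_eq (Module.annihilator R M) {q | IsAttachedPrime R M q}
    (by
      rintro p ⟨h, N, rfl⟩
      exact ⟨h, LinearMap.annihilator_le_of_surjective N.mkQ N.mkQ_surjective⟩)
    (fun p hp => att_of_minimal p hp)
  exact ⟨ha.trans hc.symm, hc⟩
end

section
/- Let R be a Noetherian ring, M an Artinian R-module with Ann_R(0 :_M p) = p for all primes p ⊇ Ann_R(M), and let p ∈ Cos_R(M). If x ∈ p lies in no attached prime of M contained in p, then ht(p/(Ann_R(M) + (x))) = ht(p/Ann_R(M)) − 1, where ht(p/a) denotes the height of p/a in R/a. -/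
/-- The co-support of an `R`-module `N`: primes `p` with `Hom_R(R_p, N) ≠ 0`. -/
def coSupport (R : Type*) [CommRing R] (N : Type*) [AddCommGroup N] [Module R N] :
    Set (PrimeSpectrum R) :=
  {p | Nontrivial (Localization.AtPrime p.asIdeal →ₗ[R] N)}

/-- The height `ht(p/a)` of the prime `p/a` in `R/a`, i.e. the height of `p` in the poset of
primes containing `a` (equal to `0` when `a ⊄ p`). -/
noncomputable def quotHeight (R : Type*) [CommRing R] (a : Ideal R) (p : PrimeSpectrum R) :
    ℕ∞ :=
  ⨆ h : a ≤ p.asIdeal, Order.height (⟨p, h⟩ : {q : PrimeSpectrum R // a ≤ q.asIdeal})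

/-- Minimal primes of the annihilator are attached. -/
lemma attached_of_minimal (R M : Type*) [CommRing R] [IsNoetherianRing R]
    [AddCommGroup M] [Module R M] (q : Ideal R)
    (hq : q ∈ (Module.annihilator R M).minimalPrimes) : IsAttachedPrime R M q := by
  have hqp : q.IsPrime := hq.1.1
  refine ⟨hqp, q • ⊤, le_antisymm ?_ ?_⟩
  · intro s hs
    by_contra hsq
    have hfin := Ideal.finite_minimalPrimes_of_isNoetherianRing R (Module.annihilator R M)
    classical
    let F : Finset (Ideal R) := hfin.toFinset.erase q
    have hF : ¬ F.inf id ≤ q := by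
      rw [Ideal.IsPrime.inf_le' hqp]
      rintro ⟨q', hq', hle⟩
      simp only [F, Finset.mem_erase, Set.Finite.mem_toFinset] at hq'
      exact hq'.1 (le_antisymm hle (hq.2 hq'.2.1 hle))
    obtain ⟨t, htF, htq⟩ := SetLike.not_le_iff_exists.1 hF
    have hrad : Ideal.span {t} * q ≤ (Module.annihilator R M).radical := by
      rw [← Ideal.sInf_minimalPrimes]
      refine le_sInf fun q' hq' => ?_
      by_cases e : q' = q
      · rw [e]; exact Ideal.mul_le_inf.trans inf_le_right
      · refine (Ideal.mul_le_inf.trans inf_le_left).trans ?_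
        rw [Ideal.span_singleton_le_iff_mem]
        have : F.inf id ≤ q' := Finset.inf_le (f := id) (by simp [F, e, hq'])
        exact this htF
    obtain ⟨n, hn⟩ := Ideal.exists_radical_pow_le_of_fg (Module.annihilator R M)
      (IsNoetherian.noetherian _)
    have h1 : Ideal.span {t} ^ n * q ^ n ≤ Module.annihilator R M := by
      rw [← mul_pow]; exact (Ideal.pow_right_mono hrad n).trans hn
    have h2 : Ideal.span {s} • (⊤ : Submodule R M) ≤ q • ⊤ := by
      rw [Submodule.smul_le]
      intro r hr m _
      obtain ⟨c, rfl⟩ := Ideal.mem_span_singleton'.1 hr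
      have := Module.mem_annihilator.1 hs (Submodule.Quotient.mk (c • m))
      rw [← Submodule.Quotient.mk_smul, Submodule.Quotient.mk_eq_zero] at this
      rwa [mul_comm, mul_smul]
    have h3 : ∀ k : ℕ, Ideal.span {s} ^ k • (⊤ : Submodule R M) ≤ q ^ k • ⊤ := by
      intro k
      induction k with
      | zero => simp
      | succ k ih =>
        calc Ideal.span {s} ^ (k + 1) • (⊤ : Submodule R M)
            = Ideal.span {s} ^ k • (Ideal.span {s} • (⊤ : Submodule R M)) := by
              rw [pow_succ, Submodule.mul_smul]
          _ ≤ Ideal.span {s} ^ k • (q • (⊤ : Submodule R M)) := Submodule.smul_mono le_rfl h2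
          _ = q • (Ideal.span {s} ^ k • (⊤ : Submodule R M)) := by
              rw [← Submodule.mul_smul, mul_comm, Submodule.mul_smul]
          _ ≤ q • (q ^ k • (⊤ : Submodule R M)) := Submodule.smul_mono le_rfl ih
          _ = _ := by rw [← Submodule.mul_smul, pow_succ']
    have h4 : t ^ n * s ^ n ∈ Module.annihilator R M := by
      rw [Module.mem_annihilator]
      intro m
      have hm : s ^ n • m ∈ q ^ n • (⊤ : Submodule R M) :=
        h3 n (Submodule.smul_mem_smul
          (Ideal.pow_mem_pow (Ideal.mem_span_singleton_self s) n) trivial)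
      have hm' : t ^ n • s ^ n • m ∈ Ideal.span {t} ^ n • (q ^ n • (⊤ : Submodule R M)) :=
        Submodule.smul_mem_smul (Ideal.pow_mem_pow (Ideal.mem_span_singleton_self t) n) hm
      rw [← Submodule.mul_smul] at hm'
      have h5 : (Ideal.span {t} ^ n * q ^ n) • (⊤ : Submodule R M) ≤ ⊥ := by
        rw [Submodule.smul_le]
        intro r hr m _
        simpa using Module.mem_annihilator.1 (h1 hr) m
      rw [mul_smul]
      simpa using h5 hm'
    rcases hqp.mem_or_mem (hq.1.2 h4) with h | h
    · exact htq (hqp.mem_of_pow_mem _ h)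
    · exact hsq (hqp.mem_of_pow_mem _ h)
  · intro a ha
    rw [Module.mem_annihilator]
    intro m
    obtain ⟨m, rfl⟩ := Submodule.Quotient.mk_surjective _ m
    rw [← Submodule.Quotient.mk_smul, Submodule.Quotient.mk_eq_zero]
    exact Submodule.smul_mem_smul ha trivial

lemma annihilator_le_of_coSupport (R M : Type*) [CommRing R]
    [AddCommGroup M] [Module R M] (p : PrimeSpectrum R) (hp : p ∈ coSupport R M) :
    Module.annihilator R M ≤ p.asIdeal := by
  intro a ha
  by_contra hap
  have : Nontrivial (Localization.AtPrime p.asIdeal →ₗ[R] M) := hp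
  obtain ⟨f, hf⟩ := exists_ne (0 : Localization.AtPrime p.asIdeal →ₗ[R] M)
  apply hf
  ext y
  have hu : IsUnit (algebraMap R (Localization.AtPrime p.asIdeal) a) :=
    IsLocalization.map_units _ (⟨a, hap⟩ : p.asIdeal.primeCompl)
  obtain ⟨z, hz⟩ := hu.dvd (a := y)
  rw [hz, ← Algebra.smul_def, map_smul, Module.mem_annihilator.1 ha, LinearMap.zero_apply]

lemma quotHeight_of_le {R : Type*} [CommRing R] {a : Ideal R} {p : PrimeSpectrum R}
    (h : a ≤ p.asIdeal) : quotHeight R a p =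
      Order.height (⟨p, h⟩ : {q : PrimeSpectrum R // a ≤ q.asIdeal}) := by
  simp [quotHeight, h]

/-- The height formula. -/
lemma quotHeight_sub_one {R : Type*} [CommRing R] [IsNoetherianRing R] (I : Ideal R)
    (p : PrimeSpectrum R) (hI : I ≤ p.asIdeal) (x : R) (hxp : x ∈ p.asIdeal)
    (hx : ∀ q ∈ I.minimalPrimes, q ≤ p.asIdeal → x ∉ q) :
    quotHeight R (I + Ideal.span {x}) p = quotHeight R I p - 1 := by
  have hJ : I + Ideal.span {x} ≤ p.asIdeal :=
    sup_le hI ((Ideal.span_singleton_le_iff_mem _).2 hxp)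
  have hIJ : I ≤ I + Ideal.span {x} := le_sup_left
  have hxJ : x ∈ I + Ideal.span {x} :=
    (le_sup_right : _ ≤ I ⊔ Ideal.span {x}) (Ideal.mem_span_singleton_self x)
  rw [quotHeight_of_le hI, quotHeight_of_le hJ]
  apply le_antisymm
  · refine Order.height_le fun r hr => ?_
    apply ENat.le_sub_of_add_le_right (by simp)
    let r' : LTSeries {q : PrimeSpectrum R // I ≤ q.asIdeal} :=
      r.map (fun q => ⟨q.1, hIJ.trans q.2⟩) (fun _ _ h => h)
    have : r.head.1.asIdeal.IsPrime := r.head.1.2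
    obtain ⟨q, hq, hqr⟩ := Ideal.exists_minimalPrimes_le (hIJ.trans r.head.2)
    have hle : r.head.1.asIdeal ≤ p.asIdeal := by
      have := LTSeries.head_le_last r
      rw [hr] at this; exact this
    have hxq := hx q hq (hqr.trans hle)
    let q' : {q : PrimeSpectrum R // I ≤ q.asIdeal} := ⟨⟨q, hq.1.1⟩, hq.1.2⟩
    have hlt : q' < r'.head := by
      refine lt_of_le_of_ne hqr ?_
      intro e
      apply hxq
      have e2 : q = r.head.1.asIdeal := congrArg (fun z => z.1.asIdeal) e
      rw [e2]; exact r.head.2 hxJ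
    have := Order.length_le_height (p := r'.cons q' hlt) (x := ⟨p, hI⟩) (by
      rw [RelSeries.last_cons]
      have : r'.last = ⟨p, hI⟩ :=
        Subtype.ext (congrArg Subtype.val hr :)
      exact this.le)
    simpa [r'] using this
  · rw [tsub_le_iff_right]
    refine Order.height_le fun r hr => ?_
    let r' : LTSeries (PrimeSpectrum R) := r.map Subtype.val (fun _ _ h => h)
    have hl : r'.last = p := (congrArg Subtype.val hr :)
    obtain ⟨s, hs1, hs2, hs3, hs4⟩ :=
      PrimeSpectrum.exist_ltSeries_mem_one_of_mem_last r' (x := x) (by rw [hl]; exact hxp)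
    have hlen : r.length = s.length := hs2
    by_cases h0 : r.length = 0
    · simp [h0]
    have h1 : ∀ i : Fin s.length, (1 : Fin (s.length + 1)) ≤ i.succ := by
      intro i
      rw [Fin.le_def, Fin.val_one', Nat.mod_eq_of_lt (by omega)]
      simp
    have hhead : s.head.asIdeal = r.head.1.asIdeal := by
      rw [← hs3]; rfl
    let u : LTSeries {q : PrimeSpectrum R // I + Ideal.span {x} ≤ q.asIdeal} :=
      { length := s.length - 1
        toFun := fun i => ⟨s ⟨i.1 + 1, by omega⟩, by
          refine sup_le ?_ ((Ideal.span_singleton_le_iff_mem _).2 ?_)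
          · refine r.head.2.trans (hhead ▸ ?_)
            exact LTSeries.monotone s (Fin.zero_le _)
          · exact (LTSeries.monotone s (h1 ⟨i.1, by omega⟩) :) hs1⟩
        step := fun i => s.strictMono (by simp [Fin.lt_def]) }
    have hu : u.last = ⟨p, hJ⟩ := by
      apply Subtype.ext
      change s _ = p
      rw [← hl, hs4]
      change s _ = s _
      congr 1
      apply Fin.ext
      simp [u]; omega
    have := Order.length_le_height (p := u) (x := ⟨p, hJ⟩) hu.le
    calc (r.length : ℕ∞) = ((u.length + 1 : ℕ) : ℕ∞) := by
          congr 1; simp [u]; omega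
      _ ≤ _ := by push_cast; gcongr

/-- Let `R` be Noetherian, `M` Artinian with `Ann_R(0 :_M p) = p` for all
primes `p ⊇ Ann_R M`, and `p ∈ Cos_R M`. If `x ∈ p` lies in no attached prime of `M` contained
in `p`, then `ht(p/(Ann_R M + (x))) = ht(p/Ann_R M) − 1`. -/
theorem quotHeight_add_coregular
    (R M : Type*) [CommRing R] [IsNoetherianRing R]
    [AddCommGroup M] [Module R M] [IsArtinian R M]
    (h : ∀ p : Ideal R, p.IsPrime → Module.annihilator R M ≤ p →
      (Submodule.torsionBySet R M (p : Set R)).annihilator = p)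
    (p : PrimeSpectrum R) (hp : p ∈ coSupport R M)
    (x : R) (hxp : x ∈ p.asIdeal)
    (hx : ∀ q : Ideal R, IsAttachedPrime R M q → q ≤ p.asIdeal → x ∉ q) :
    quotHeight R (Module.annihilator R M + Ideal.span {x}) p
      = quotHeight R (Module.annihilator R M) p - 1 := by
  exact quotHeight_sub_one _ p (annihilator_le_of_coSupport R M p hp) x hxp
    fun q hq hqp => hx q (attached_of_minimal R M q hq) hqp
end

section
/- Let R be a Noetherian ring and M an Artinian R-module such that Ann_R(0 :_M p) = p for all primes p ⊇ Ann_R(M). Suppose x_1, ..., x_d ∈ J(M) are elements such that (0 :_M (x_1,...,x_d)) is nonzero of finite length. Then dim R/Ann_R(M) ≤ d. -/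
/-- `J(M)`, the intersection of all maximal ideals lying in the support of `M`. -/
def suppJacobson (R : Type*) [CommRing R] (M : Type*) [AddCommGroup M] [Module R M] :
    Ideal R :=
  sInf {m : Ideal R | ∃ h : m.IsMaximal,
    (⟨m, h.isPrime⟩ : PrimeSpectrum R) ∈ Module.support R M}

theorem isMaximal_of_annihilator_eq {R N : Type*} [CommRing R] [AddCommGroup N] [Module R N]
    (hN : IsFiniteLength R N) (p : Ideal R) [hp : p.IsPrime]
    (h : Module.annihilator R N = p) : p.IsMaximal := by
  obtain ⟨_, _⟩ := isFiniteLength_iff_isNoetherian_isArtinian.mp hN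
  obtain ⟨n, s, hs⟩ := Module.Finite.exists_fin (R := R) (M := N)
  let f : R →ₗ[R] (Fin n → N) := LinearMap.pi fun i => LinearMap.toSpanSingleton R N (s i)
  have hf : LinearMap.ker f = p := by
    ext r
    rw [← h, ← Submodule.annihilator_top, ← hs, Submodule.mem_annihilator_span]
    simp [f, funext_iff]
  have e : IsArtinian R (R ⧸ p) := by
    have := (LinearMap.quotKerEquivRange f).symm.isArtinian_iff.mp inferInstance
    rwa [hf] at this
  have : IsArtinianRing (R ⧸ p) := isArtinian_of_tower R e
  have hb : (⊥ : Ideal (R ⧸ p)).IsMaximal := IsArtinianRing.isMaximal_of_isPrime _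
  exact Ideal.Quotient.maximal_of_isField p
    (Ring.isField_iff_maximal_bot.mpr hb)

/-- Let `R` be Noetherian and `M` Artinian with `Ann_R(0 :_M p) = p` for all
primes `p ⊇ Ann_R M`. If `x_1, …, x_d ∈ J(M)` are such that `(0 :_M (x_1,…,x_d))` is nonzero
of finite length, then `dim R/Ann_R M ≤ d`. -/
theorem krullDim_quotient_annihilator_le
    (R M : Type*) [CommRing R] [IsNoetherianRing R]
    [AddCommGroup M] [Module R M] [IsArtinian R M]
    (h : ∀ p : Ideal R, p.IsPrime → Module.annihilator R M ≤ p →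
      (Submodule.torsionBySet R M (p : Set R)).annihilator = p)
    (d : ℕ) (x : Fin d → R) (hx : ∀ i, x i ∈ suppJacobson R M)
    (hne : Submodule.torsionBySet R M ((Ideal.span (Set.range x) : Ideal R) : Set R) ≠ ⊥)
    (hfl : IsFiniteLength R
      (Submodule.torsionBySet R M ((Ideal.span (Set.range x) : Ideal R) : Set R))) :
    ringKrullDim (R ⧸ Module.annihilator R M) ≤ (d : WithBot (WithTop ℕ)) := by
  set A := Module.annihilator R M with hA
  suffices H : ringKrullDim (R ⧸ A) ≤ ((d : ℕ∞) : WithBot ℕ∞) from H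
  rw [ringKrullDim_le_iff_isMaximal_height_le]
  intro m hm
  have key : ∀ q : Ideal (R ⧸ A), q.IsPrime →
      Ideal.span (Set.range fun i => Ideal.Quotient.mk A (x i)) ≤ q → q.IsMaximal := by
    intro q hq hle
    have hp : (q.comap (Ideal.Quotient.mk A)).IsPrime := inferInstance
    have hAp : A ≤ q.comap (Ideal.Quotient.mk A) := by
      intro a ha
      rw [Ideal.mem_comap, Ideal.Quotient.eq_zero_iff_mem.mpr ha]
      exact q.zero_mem
    have hIp : Ideal.span (Set.range x) ≤ q.comap (Ideal.Quotient.mk A) := by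
      rw [Ideal.span_le]
      rintro _ ⟨i, rfl⟩
      exact hle (Ideal.subset_span ⟨i, rfl⟩)
    have hsub := Submodule.torsionBySet_le_torsionBySet_of_subset (M := M)
      (show ((Ideal.span (Set.range x) : Ideal R) : Set R) ⊆
        ((q.comap (Ideal.Quotient.mk A) : Ideal R) : Set R) from hIp)
    have hmax := isMaximal_of_annihilator_eq
      (hfl.of_injective (Submodule.inclusion_injective hsub)) _ (h _ hp hAp)
    have := Ideal.map_eq_top_or_isMaximal_of_surjective (Ideal.Quotient.mk A)
      Ideal.Quotient.mk_surjective hmax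
    rw [Ideal.map_comap_of_surjective _ Ideal.Quotient.mk_surjective] at this
    exact this.resolve_left hq.ne_top
  have hxm : Ideal.span (Set.range fun i => Ideal.Quotient.mk A (x i)) ≤ m := by
    rw [Ideal.span_le]
    rintro _ ⟨i, rfl⟩
    have hp : (m.comap (Ideal.Quotient.mk A)).IsMaximal :=
      Ideal.comap_isMaximal_of_surjective _ Ideal.Quotient.mk_surjective
    have hAp : A ≤ m.comap (Ideal.Quotient.mk A) := by
      intro a ha
      rw [Ideal.mem_comap, Ideal.Quotient.eq_zero_iff_mem.mpr ha]
      exact m.zero_mem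
    have hann := h _ hp.isPrime hAp
    have hnb : Submodule.torsionBySet R M
        ((m.comap (Ideal.Quotient.mk A) : Ideal R) : Set R) ≠ ⊥ := by
      intro hb
      rw [hb, Submodule.annihilator_bot] at hann
      exact hp.ne_top hann.symm
    obtain ⟨y, hy, hy0⟩ := Submodule.exists_mem_ne_zero_of_ne_bot hnb
    have hle : m.comap (Ideal.Quotient.mk A) ≤ (Submodule.span R {y}).annihilator := by
      intro r hr
      rw [Submodule.mem_annihilator_span_singleton]
      exact (Submodule.mem_torsionBySet_iff _ _).mp hy ⟨r, hr⟩
    have heq := hp.eq_of_le (by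
      rw [Ne, Submodule.annihilator_eq_top_iff, Submodule.span_singleton_eq_bot]
      exact hy0) hle
    have hmem := hx i
    rw [suppJacobson, Submodule.mem_sInf] at hmem
    exact hmem _ ⟨hp, Module.mem_support_iff_exists_annihilator.mpr ⟨y, heq.ge⟩⟩
  have hmin : m ∈ (Ideal.span (Set.range fun i => Ideal.Quotient.mk A (x i))).minimalPrimes :=
    ⟨⟨hm.isPrime, hxm⟩, fun q hq hqm =>
      ((key q hq.1 hq.2).eq_of_le hm.ne_top hqm).ge⟩
  have hht := Ideal.height_le_card_of_mem_minimalPrimes_span (Set.finite_range _) hmin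
  have hc : (Set.range fun i => Ideal.Quotient.mk A (x i)).ncard ≤ d := by
    rw [← Set.image_univ]
    refine (Set.ncard_image_le Set.finite_univ).trans ?_
    simp [Set.ncard_univ]
  have := hht.trans (Nat.cast_le.mpr hc)
  exact WithBot.coe_le_coe.mpr this
end
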